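/- Let N = (N_i)_{i≥0} be a sequence of nonnegative real matrices in (2×2) upper triangular block form N_i = [[A_i, C_i],[0, B_i]], and set N̊_i = [[A_i, 0],[0, 0]]. Then for every v ∈ V_N and every i ≥ 0, the limit lim_{n→∞} N̊_i^n v_{n+1} exists. -/

import Mathlib

open Filter Topology Matrix

noncomputable section

/-- The product `N_k N_{k+1} ⋯ N_{k+m}` of a nonstationary sequence of matrices,
i.e. the matrix written `N_k^n` (with `n = k + m`) in the paper. -/
def matProd {A : ℕ → Type} [∀ i, Fintype (A i)]
    (N : ∀ i, Matrix (A i) (A (i + 1)) ℝ) (k : ℕ) :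
    ∀ m : ℕ, Matrix (A k) (A (k + m + 1)) ℝ
  | 0 => N k
  | m + 1 => matProd N k m * N (k + m + 1)

/-- `V_N^0`: nonnegative fixed-point sequences (`w_i ∈ C_i`, `w_i = N_i w_{i+1}`). -/
def V0 {A : ℕ → Type} [∀ i, Fintype (A i)] (N : ∀ i, Matrix (A i) (A (i + 1)) ℝ) :
    Set (∀ i, A i → ℝ) :=
  {w | (∀ i a, 0 ≤ w i a) ∧ ∀ i, w i = (N i).mulVec (w (i + 1))}

/-- `V_N`: nonnegative eigenvector sequences of eigenvalue one (never zero). -/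
def Vpos {A : ℕ → Type} [∀ i, Fintype (A i)] (N : ∀ i, Matrix (A i) (A (i + 1)) ℝ) :
    Set (∀ i, A i → ℝ) := {w | w ∈ V0 N ∧ ∀ i, w i ≠ 0}

/-- `V_N^Δ`: members of `V_N` whose initial vector lies in the unit simplex `Δ₀`
(for the `L¹` norm `‖u‖ = ∑ₐ |u a|`). -/
def VDelta {A : ℕ → Type} [∀ i, Fintype (A i)] (N : ∀ i, Matrix (A i) (A (i + 1)) ℝ) :
    Set (∀ i, A i → ℝ) := {w | w ∈ Vpos N ∧ ∑ a, |w 0 a| = 1}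

/-- The sequence `N` is primitive: for every `k` there is `n > k` (here `n = k + m`, `m ≥ 1`)
such that every entry of `N_k^n` is strictly positive. -/
def Primitive {A : ℕ → Type} [∀ i, Fintype (A i)] (N : ∀ i, Matrix (A i) (A (i + 1)) ℝ) : Prop :=
  ∀ k, ∃ m, 0 < m ∧ ∀ (a : A k) (b : A (k + m + 1)), 0 < matProd N k m a b

/-- The matrix sequence `N̊` with `N̊_i = [[A_i, 0],[0, 0]]`, obtained from a `(2×2)`
block sequence `N_i = [[A_i, C_i],[0, B_i]]` on the alphabets `α_i ⊕ β_i`. -/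
def ringed {α β : ℕ → Type} (N : ∀ i, Matrix (α i ⊕ β i) (α (i + 1) ⊕ β (i + 1)) ℝ) :
    ∀ i, Matrix (α i ⊕ β i) (α (i + 1) ⊕ β (i + 1)) ℝ :=
  fun i => Matrix.of fun x y =>
    match x, y with
    | Sum.inl a, Sum.inl b => N i (Sum.inl a) (Sum.inl b)
    | _, _ => 0

lemma ringed_nonneg {α β : ℕ → Type}
    {N : ∀ i, Matrix (α i ⊕ β i) (α (i + 1) ⊕ β (i + 1)) ℝ}
    (hN0 : ∀ i x y, 0 ≤ N i x y) (i : ℕ) (x y) : 0 ≤ ringed N i x y := by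
  rcases x with a | b <;> rcases y with c | d <;> simp [ringed, hN0]

lemma ringed_le {α β : ℕ → Type}
    {N : ∀ i, Matrix (α i ⊕ β i) (α (i + 1) ⊕ β (i + 1)) ℝ}
    (hN0 : ∀ i x y, 0 ≤ N i x y) (i : ℕ) (x y) : ringed N i x y ≤ N i x y := by
  rcases x with a | b <;> rcases y with c | d <;> simp [ringed, hN0]

lemma matProd_nonneg {A : ℕ → Type} [∀ i, Fintype (A i)]
    {N : ∀ i, Matrix (A i) (A (i + 1)) ℝ} (hN : ∀ i x y, 0 ≤ N i x y) (k m : ℕ) (x y) :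
    0 ≤ matProd N k m x y := by
  induction m with
  | zero => exact hN k x y
  | succ m ih => exact Finset.sum_nonneg fun z _ => mul_nonneg (ih z) (hN _ z y)

/-- If `0 ≤ M` and `M_i v_{i+1} ≤ v_i` for a nonnegative sequence `v`, then the vectors
`M_k^n v_{n+1}` decrease to a limit. -/
lemma exists_tendsto_matProd_mulVec {A : ℕ → Type} [∀ i, Fintype (A i)]
    {M : ∀ i, Matrix (A i) (A (i + 1)) ℝ} (hM : ∀ i x y, 0 ≤ M i x y)
    {v : ∀ i, A i → ℝ} (hv : ∀ i a, 0 ≤ v i a)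
    (hle : ∀ i a, (M i).mulVec (v (i + 1)) a ≤ v i a) (k : ℕ) :
    ∃ u : A k → ℝ, Tendsto (fun m => (matProd M k m).mulVec (v (k + m + 1))) atTop (𝓝 u) := by
  refine ⟨_, tendsto_pi_nhds.mpr fun x => tendsto_atTop_ciInf (antitone_nat_of_succ_le ?_) ?_⟩
  · intro m
    change (matProd M k m * M (k + m + 1)).mulVec (v (k + m + 1 + 1)) x ≤ _
    rw [← Matrix.mulVec_mulVec]
    exact Finset.sum_le_sum fun z _ =>
      mul_le_mul_of_nonneg_left (hle _ z) (matProd_nonneg hM k m x z)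
  · refine ⟨0, ?_⟩
    rintro _ ⟨m, rfl⟩
    exact Finset.sum_nonneg fun z _ => mul_nonneg (matProd_nonneg hM k m x z) (hv _ z)

/-- for a sequence `N` of nonnegative real matrices in `(2×2)` upper triangular
block form `N_i = [[A_i, C_i],[0, B_i]]`, and `N̊_i = [[A_i, 0],[0, 0]]`, for every `v ∈ V_N`
and every `i ≥ 0` the limit `lim_{n→∞} N̊_i^n v_{n+1}` exists. -/
theorem statement16 (α β : ℕ → Type) [∀ i, Fintype (α i)] [∀ i, Fintype (β i)]
    [∀ i, Nonempty (α i)] [∀ i, Nonempty (β i)]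
    (N : ∀ i, Matrix (α i ⊕ β i) (α (i + 1) ⊕ β (i + 1)) ℝ)
    (hN0 : ∀ i x y, 0 ≤ N i x y)
    (htri : ∀ i (b : β i) (a : α (i + 1)), N i (Sum.inr b) (Sum.inl a) = 0) :
    ∀ v ∈ Vpos N, ∀ i, ∃ u : (α i ⊕ β i) → ℝ,
      Tendsto (fun m => (matProd (A := fun j => α j ⊕ β j) (ringed N) i m).mulVec (v (i + m + 1)))
        atTop (𝓝 u) := by
  rintro v ⟨⟨hv, hfix⟩, -⟩ i
  refine exists_tendsto_matProd_mulVec (A := fun j => α j ⊕ β j) (ringed_nonneg hN0) hv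
    (fun j x => ?_) i
  rw [hfix j]
  exact Finset.sum_le_sum fun z _ => mul_le_mul_of_nonneg_right (ringed_le hN0 j x z) (hv _ z)
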